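/- Let A be a real unital Banach algebra (complete submultiplicative norm, with unit e) and suppose there is a constant m > 0 such that ‖a‖ ≤ m·r(a) for all a ∈ A, where r(a) = lim_{n→∞} ‖aⁿ‖^{1/n}. Then for all a ∈ A and all s, t ∈ ℝ, the element (a − s·e)² + t²·e fails to be invertible in A if and only if there exists a nonzero ℝ-algebra homomorphism x : A → ℍ such that (x(a) − s)² + t² = 0 in ℍ. -/

import Mathlib

open Filter Quaternion

/-- If every norm is at most `m` times the spectral radius, then conjugation by units is bounded
by `m`. -/
theorem norm_units_conj_le {A : Type*} [NormedRing A] {r : A → ℝ}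
    (hr : ∀ a : A, Tendsto (fun n : ℕ => ‖a ^ n‖ ^ (1 / (n : ℝ))) atTop (nhds (r a)))
    {m : ℝ} (hm : 0 < m) (hnorm : ∀ a : A, ‖a‖ ≤ m * r a) (u : Aˣ) (b : A) :
    ‖↑u * b * ↑u⁻¹‖ ≤ m * ‖b‖ := by
  refine (hnorm _).trans (mul_le_mul_of_nonneg_left ?_ hm.le)
  set C : ℝ := ‖(u : A)‖ * ‖(↑u⁻¹ : A)‖ + 1 with hC
  have hC0 : 0 < C := by positivity
  have hlim : Tendsto (fun n : ℕ => C ^ (1 / (n : ℝ)) * ‖b‖) atTop (nhds ‖b‖) := by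
    have h := (Real.continuousAt_const_rpow (b := 0) hC0.ne').tendsto.comp
      tendsto_one_div_atTop_nhds_zero_nat
    simpa using h.mul_const ‖b‖
  refine le_of_tendsto_of_tendsto (hr _) hlim ?_
  filter_upwards [eventually_gt_atTop 0] with n hn
  have hle : ‖(↑u * b * ↑u⁻¹) ^ n‖ ≤ C * ‖b‖ ^ n := by
    rw [Units.conj_pow]
    calc ‖(u : A) * b ^ n * ↑u⁻¹‖ ≤ ‖(u : A)‖ * ‖b ^ n‖ * ‖(↑u⁻¹ : A)‖ :=
          (norm_mul_le _ _).trans (mul_le_mul_of_nonneg_right (norm_mul_le _ _) (norm_nonneg _))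
      _ = (‖(u : A)‖ * ‖(↑u⁻¹ : A)‖) * ‖b ^ n‖ := by ring
      _ ≤ C * ‖b‖ ^ n := by
          gcongr
          · linarith
          · exact norm_pow_le' b hn
  calc ‖(↑u * b * ↑u⁻¹) ^ n‖ ^ (1 / (n : ℝ)) ≤ (C * ‖b‖ ^ n) ^ (1 / (n : ℝ)) :=
        Real.rpow_le_rpow (norm_nonneg _) hle (by positivity)
    _ = C ^ (1 / (n : ℝ)) * ‖b‖ := by
        rw [Real.mul_rpow hC0.le (by positivity), one_div,
          Real.pow_rpow_inv_natCast (norm_nonneg _) hn.ne']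

/-- If `y` is an eigenvector of `a` modulo a closed left ideal, then it is one of `exp a`. -/
theorem exp_mul_sub_smul_mem {A : Type*} [NormedRing A] [CompleteSpace A] [NormedAlgebra ℝ A]
    {L : Ideal A} (hL : IsClosed (L : Set A)) {a y : A} {c : ℝ} (h : a * y - c • y ∈ L) :
    NormedSpace.exp a * y - Real.exp c • y ∈ L := by
  have hpow : ∀ n : ℕ, a ^ n * y - c ^ n • y ∈ L := by
    intro n
    induction n with
    | zero => simp
    | succ n ih =>
      have h1 := L.mul_mem_left a ih
      have h2 := L.mul_mem_left (algebraMap ℝ A (c ^ n)) h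
      convert L.add_mem h1 h2 using 1
      rw [← Algebra.smul_def, mul_sub, smul_sub, mul_smul_comm, smul_smul, pow_succ', pow_succ',
        mul_assoc, mul_comm c]
      abel
  have hs := ((NormedSpace.exp_series_hasSum_exp' (𝕂 := ℝ) a).mul_right y).sub
    ((NormedSpace.exp_series_hasSum_exp' (𝕂 := ℝ) c).smul_const y)
  rw [Real.exp_eq_exp_ℝ]
  refine hL.mem_of_tendsto hs (Eventually.of_forall fun s => L.sum_mem fun n _ => ?_)
  convert L.mul_mem_left (algebraMap ℝ A ((n.factorial : ℝ)⁻¹)) (hpow n) using 1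
  rw [← Algebra.smul_def, smul_sub, smul_mul_assoc, smul_assoc]

/-- If conjugation by units is uniformly bounded, then maximal left ideals are two-sided. -/
theorem isTwoSided_of_isMaximal {A : Type*} [NormedRing A] [CompleteSpace A] [NormedAlgebra ℝ A]
    {m : ℝ} (hconj : ∀ (u : Aˣ) (b : A), ‖↑u * b * ↑u⁻¹‖ ≤ m * ‖b‖)
    {L : Ideal A} (hL : L.IsMaximal) : L.IsTwoSided := by
  have hcl : IsClosed (L : Set A) := by
    rw [← hL.closure_eq]; exact isClosed_closure
  refine ⟨fun {l} x hl => ?_⟩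
  by_contra hlx
  have hx : x ∉ L := fun hx => hlx (L.mul_mem_left l hx)
  obtain ⟨b, i, hi, hbi⟩ := hL.exists_inv hx
  obtain ⟨c, j, hj, hcj⟩ := hL.exists_inv hlx
  set a : A := x * c * l with ha_def
  have haL : a ∈ L := L.mul_mem_left _ hl
  have hax : a * x - x ∈ L := by
    have : a * x - x = -(x * j) := by
      have : x * (c * (l * x) + j) = x := by rw [hcj, mul_one]
      nth_rw 2 [← this]
      rw [ha_def]
      noncomm_ring
    rw [this]
    exact L.neg_mem (L.mul_mem_left _ hj)
  have hone : ∀ y ∈ L, 1 ≤ ‖1 - y‖ := fun y hy => by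
    by_contra! h
    exact hL.ne_top (L.eq_top_of_norm_lt_one hy h)
  have key : ∀ t : ℝ, Real.exp t ≤ m * ‖b‖ * ‖x‖ := by
    intro t
    let : NormedAlgebra ℚ A := NormedAlgebra.restrictScalars ℚ ℝ A
    let := NormedSpace.invertibleExp (t • a)
    let u : Aˣ := ⟨NormedSpace.exp (-(t • a)), NormedSpace.exp (t • a),
      invOf_mul_self (NormedSpace.exp (t • a)), mul_invOf_self (NormedSpace.exp (t • a))⟩
    have h1 : NormedSpace.exp (t • a) * x - Real.exp t • x ∈ L := by
      apply exp_mul_sub_smul_mem hcl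
      have := L.mul_mem_left (algebraMap ℝ A t) hax
      rwa [← Algebra.smul_def, smul_sub, ← smul_mul_assoc] at this
    have h2 : NormedSpace.exp (-(t • a)) * 1 - Real.exp 0 • 1 ∈ L := by
      apply exp_mul_sub_smul_mem hcl
      have := L.mul_mem_left (algebraMap ℝ A (-t)) haL
      rw [← Algebra.smul_def] at this
      simpa using this
    have hmem : ↑u * b * ↑u⁻¹ * x - Real.exp t • 1 ∈ L := by
      convert L.add_mem (L.mul_mem_left (↑u * b) h1) (L.mul_mem_left (algebraMap ℝ A (Real.exp t))
        (L.sub_mem h2 (L.mul_mem_left (↑u) hi))) using 1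
      have hubx : ↑u * b * x = u - u * i := by
        rw [mul_assoc, eq_sub_of_add_eq hbi, mul_sub, mul_one]
      rw [← Algebra.smul_def, mul_sub, mul_smul_comm, hubx, Real.exp_zero, one_smul, ← mul_assoc,
        mul_one]
      change _ * _ - _ = _ * _ - _ + _ • ((u : A) - _ - _)
      module
    have h3 : Real.exp t ≤ ‖↑u * b * ↑u⁻¹ * x‖ := by
      have := hone _ (L.mul_mem_left (algebraMap ℝ A (-Real.exp (-t))) hmem)
      rw [← Algebra.smul_def, smul_sub, smul_smul, neg_mul, ← Real.exp_add, neg_add_cancel,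
        Real.exp_zero, neg_one_smul, sub_neg_eq_add, sub_add_cancel_right, neg_smul, neg_neg,
        norm_smul, Real.norm_of_nonneg (Real.exp_pos _).le, Real.exp_neg] at this
      rwa [← div_eq_inv_mul, one_le_div (Real.exp_pos _)] at this
    exact h3.trans ((norm_mul_le _ _).trans
      (mul_le_mul_of_nonneg_right (hconj u b) (norm_nonneg _)))
  have := key (m * ‖b‖ * ‖x‖)
  linarith [Real.add_one_le_exp (m * ‖b‖ * ‖x‖)]

/-- Both components of the real resolvent of `d` vanish at infinity. -/
theorem tendsto_ringInverse_cocompact {A : Type*} [NormedRing A] [CompleteSpace A]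
    [NormedAlgebra ℝ A] (d : A) :
    Tendsto (fun z : ℂ => (d - algebraMap ℝ A z.re) *
      Ring.inverse ((d - algebraMap ℝ A z.re) ^ 2 + algebraMap ℝ A (z.im ^ 2)))
      (cocompact ℂ) (nhds 0) ∧
    Tendsto (fun z : ℂ => z.im •
      Ring.inverse ((d - algebraMap ℝ A z.re) ^ 2 + algebraMap ℝ A (z.im ^ 2)))
      (cocompact ℂ) (nhds 0) := by
  have hnorm : Tendsto (fun z : ℂ => ‖z‖⁻¹) (cocompact ℂ) (nhds 0) :=
    tendsto_inv_atTop_zero.comp (tendsto_norm_cocompact_atTop (E := ℂ))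
  have hn : Tendsto (fun z : ℂ => (Complex.normSq z)⁻¹) (cocompact ℂ) (nhds 0) := by
    simpa [Complex.normSq_eq_norm_sq] using hnorm.pow 2
  have hdiv : ∀ g : ℂ → ℝ, (∀ z, |g z| ≤ ‖z‖) →
      Tendsto (fun z : ℂ => g z * (Complex.normSq z)⁻¹) (cocompact ℂ) (nhds 0) := by
    intro g hg
    refine squeeze_zero_norm (fun z => ?_) hnorm
    rw [norm_mul, norm_inv, Complex.normSq_eq_norm_sq, norm_pow, norm_norm, Real.norm_eq_abs]
    rcases eq_or_ne z 0 with rfl | hz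
    · simp
    have : 0 < ‖z‖ := norm_pos_iff.2 hz
    rw [← div_eq_mul_inv, div_le_iff₀ (by positivity), sq, inv_mul_cancel_left₀ this.ne']
    exact hg z
  have hre := hdiv _ Complex.abs_re_le_norm
  have him := hdiv _ Complex.abs_im_le_norm
  set e : ℂ → A := fun z => (2 * (z.re * (Complex.normSq z)⁻¹)) • d -
    (Complex.normSq z)⁻¹ • d ^ 2 with he
  have hinv : Tendsto (fun z => Ring.inverse (1 - e z)) (cocompact ℂ) (nhds 1) := by
    have h0 : Tendsto e (cocompact ℂ) (nhds 0) := by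
      simpa using ((hre.const_mul 2).smul_const d).sub (hn.smul_const (d ^ 2))
    have h1 : Tendsto (fun z => 1 - e z) (cocompact ℂ) (nhds ((1 : Aˣ) : A)) := by
      simpa using h0.const_sub 1
    have h2 := (NormedRing.inverse_continuousAt (1 : Aˣ)).tendsto.comp h1
    rwa [Ring.inverse_unit, inv_one, Units.val_one] at h2
  have hR : ∀ z : ℂ, z ≠ 0 →
      Ring.inverse ((d - algebraMap ℝ A z.re) ^ 2 + algebraMap ℝ A (z.im ^ 2)) =
        (Complex.normSq z)⁻¹ • Ring.inverse (1 - e z) := by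
    intro z hz
    have hz' : Complex.normSq z ≠ 0 := Complex.normSq_eq_zero.not.2 hz
    have h1 : (d - algebraMap ℝ A z.re) ^ 2 + algebraMap ℝ A (z.im ^ 2) =
        algebraMap ℝ A (Complex.normSq z) * (1 - e z) := by
      rw [← Algebra.smul_def, he]
      simp only [smul_sub, smul_smul]
      rw [mul_inv_cancel₀ hz', one_smul, mul_left_comm, mul_left_comm _ z.re, mul_inv_cancel₀ hz',
        Complex.normSq_apply]
      simp only [Algebra.algebraMap_eq_smul_one, sq, sub_mul, mul_sub, smul_mul_assoc,
        mul_smul_comm, one_mul, mul_one]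
      module
    let c : Aˣ := Units.map (algebraMap ℝ A).toMonoidHom (Units.mk0 _ hz')
    have hc : algebraMap ℝ A (Complex.normSq z) = c := rfl
    rw [h1, hc, Ring.inverse_mul (Or.inl c.isUnit), Ring.inverse_unit, Algebra.smul_def]
    exact (Algebra.commutes _ _).symm
  have hev : ∀ᶠ z : ℂ in cocompact ℂ, z ≠ 0 :=
    (isCompact_singleton (x := (0 : ℂ))).compl_mem_cocompact
  constructor
  · have := ((hn.smul_const d).sub (hre.smul_const (1 : A))).mul hinv
    simp only [zero_smul, sub_zero, zero_mul] at this
    refine this.congr' ?_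
    filter_upwards [hev] with z hz
    rw [hR z hz, mul_smul_comm, ← smul_mul_assoc, smul_sub, Algebra.algebraMap_eq_smul_one,
      smul_smul, mul_comm z.re]
  · have := him.smul hinv
    simp only [zero_smul] at this
    refine this.congr' ?_
    filter_upwards [hev] with z hz
    rw [hR z hz, smul_smul]

/-- A form of the real **Gelfand-Mazur theorem**: the spectrum of an element of a nontrivial real
Banach algebra is nonempty. -/
theorem exists_not_isUnit_sub_sq_add {A : Type*} [NormedRing A] [CompleteSpace A]
    [NormedAlgebra ℝ A] [Nontrivial A] (d : A) :
    ∃ s t : ℝ, ¬ IsUnit ((d - algebraMap ℝ A s) ^ 2 + algebraMap ℝ A (t ^ 2)) := by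
  by_contra! h
  set R : ℂ → A := fun z =>
    Ring.inverse ((d - algebraMap ℝ A z.re) ^ 2 + algebraMap ℝ A (z.im ^ 2)) with hRdef
  have hzero : ∀ (φ : A →L[ℝ] ℝ) (z : ℂ), φ ((d - algebraMap ℝ A z.re) * R z) = 0 := by
    intro φ
    let f : ℂ → ℂ := fun z =>
      (φ ((d - algebraMap ℝ A z.re) * R z) : ℂ) + (φ (z.im • R z) : ℂ) * Complex.I
    have hf : Differentiable ℂ f := by
      intro z
      obtain ⟨w, hw⟩ := h z.re z.im
      have hRw : R z = ↑w⁻¹ := by rw [hRdef]; simp only [← hw, Ring.inverse_unit]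
      have hu : HasFDerivAt (𝕜 := ℝ) (fun z : ℂ => d - algebraMap ℝ A z.re)
          (-(Complex.reCLM.smulRight (1 : A))) z := by
        simpa only [Algebra.algebraMap_eq_smul_one, Complex.reCLM_apply,
          ContinuousLinearMap.smulRight_apply] using
          (Complex.reCLM.smulRight (1 : A)).hasFDerivAt.const_sub d
      have him : HasFDerivAt (𝕜 := ℝ) (fun z : ℂ => z.im) Complex.imCLM z :=
        Complex.imCLM.hasFDerivAt
      have hq := (hu.mul' hu).add ((him.mul him).smul_const (1 : A))
      have hR := hasFDerivAt_ringInverse (𝕜 := ℝ) w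
      rw [hw] at hR
      have hq' : HasFDerivAt (𝕜 := ℝ) (fun z : ℂ => (d - algebraMap ℝ A z.re) ^ 2 +
        algebraMap ℝ A (z.im ^ 2)) _ z := hq.congr_of_eventuallyEq (Eventually.of_forall fun z => by
          simp [Algebra.algebraMap_eq_smul_one, sq])
      have hR' : HasFDerivAt (𝕜 := ℝ) R _ z := HasFDerivAt.comp (g := Ring.inverse) z hR hq'
      have hP := hu.mul' hR'
      have hQ := him.smul hR'
      have hF := (Complex.ofRealCLM.hasFDerivAt.comp z (φ.hasFDerivAt.comp z hP)).add
        ((Complex.ofRealCLM.hasFDerivAt.comp z (φ.hasFDerivAt.comp z hQ)).mul_const Complex.I)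
      have hF' : HasFDerivAt (𝕜 := ℝ) f _ z := hF
      rw [differentiableAt_complex_iff_differentiableAt_real]
      refine ⟨hF'.differentiableAt, ?_⟩
      rw [hF'.fderiv]
      have hcomm : Commute (d - algebraMap ℝ A z.re) (↑w⁻¹ : A) := by
        refine Commute.units_inv_right ?_
        rw [hw]
        exact ((Commute.refl _).pow_right 2).add_right (Algebra.commutes _ _).symm
      have h1 : (↑w⁻¹ : A) * (d - algebraMap ℝ A z.re) * ↑w⁻¹ =
          (d - algebraMap ℝ A z.re) * (↑w⁻¹ * ↑w⁻¹) := by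
        rw [← hcomm.eq, mul_assoc]
      have h2 : (d - algebraMap ℝ A z.re) * ((d - algebraMap ℝ A z.re) * (↑w⁻¹ * ↑w⁻¹)) =
          ↑w⁻¹ - (z.im ^ 2) • (↑w⁻¹ * ↑w⁻¹ : A) := by
        rw [← mul_assoc, ← sq, eq_sub_iff_add_eq, Algebra.smul_def, ← add_mul, ← hw,
          Units.mul_inv_cancel_left]
      simp [h1, h2, hRw]
      linear_combination (-2 * z.im * φ ((d - algebraMap ℝ A z.re) * (↑w⁻¹ * ↑w⁻¹))) * Complex.I_sq
    have hlim : Tendsto f (cocompact ℂ) (nhds 0) := by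
      obtain ⟨h1, h2⟩ := tendsto_ringInverse_cocompact d
      have h3 := (φ.continuous.tendsto 0).comp h1
      have h4 := (φ.continuous.tendsto 0).comp h2
      rw [map_zero] at h3 h4
      have := ((Complex.continuous_ofReal.tendsto 0).comp h3).add
        (((Complex.continuous_ofReal.tendsto 0).comp h4).mul_const Complex.I)
      simpa [Function.comp_def, f, R] using this
    intro z
    have := congrArg Complex.re (hf.apply_eq_of_tendsto_cocompact z hlim)
    simpa [f] using this
  have hd : ∀ s : ℝ, d = algebraMap ℝ A s := by
    intro s
    have h0 : (d - algebraMap ℝ A s) * R s = 0 := by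
      by_contra hne
      obtain ⟨φ, hφ⟩ := SeparatingDual.exists_ne_zero (R := ℝ) hne
      exact hφ (hzero φ s)
    have hR : IsUnit (R s) := (h s 0).ringInverse
    exact sub_eq_zero.1 (hR.mul_left_eq_zero.1 h0)
  have := (hd 0).symm.trans (hd 1)
  simp at this

/-- Algebra homomorphisms out of a division ring factor through its nontrivial quotients. -/
theorem nonempty_algHom_of_surjective {R B C D : Type*} [CommRing R] [DivisionRing B] [Ring C]
    [Ring D] [Nontrivial D] [Algebra R B] [Algebra R C] [Algebra R D] (f : B →ₐ[R] D)
    (hf : Function.Surjective f) (g : B →ₐ[R] C) : Nonempty (D →ₐ[R] C) :=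
  ⟨g.comp (AlgEquiv.ofBijective f ⟨f.toRingHom.injective, hf⟩).symm.toAlgHom⟩

/-- A form of the **Frobenius theorem**: a real division algebra all of whose elements are
roots of real polynomials `(X - s)² + t²` embeds into the quaternions. -/
theorem nonempty_algHom_quaternion {D : Type*} [DivisionRing D] [Algebra ℝ D]
    (h : ∀ d : D, ∃ s t : ℝ, (d - algebraMap ℝ D s) ^ 2 + algebraMap ℝ D (t ^ 2) = 0) :
    Nonempty (D →ₐ[ℝ] ℍ[ℝ]) := by
  by_cases hi : ∃ i : D, i * i = -1
  swap
  · refine nonempty_algHom_of_surjective (Algebra.ofId ℝ D) (fun d => ?_) (Algebra.ofId ℝ ℍ[ℝ])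
    obtain ⟨s, t, hst⟩ := h d
    refine ⟨s, ?_⟩
    rw [Algebra.ofId_apply, eq_comm, ← sub_eq_zero]
    by_contra hne
    have ht : t ≠ 0 := by
      rintro rfl
      simp [hne] at hst
    refine hi ⟨t⁻¹ • (d - algebraMap ℝ D s), ?_⟩
    rw [smul_mul_smul_comm, ← sq (d - _), eq_neg_of_add_eq_zero_left hst, smul_neg,
      Algebra.algebraMap_eq_smul_one, smul_smul, ← mul_inv, ← sq, inv_mul_cancel₀ (pow_ne_zero 2 ht),
      one_smul]
  obtain ⟨i, hii⟩ := hi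
  have hcomm : ∀ d : D, i * d = d * i → ∃ x y : ℝ, d = x • 1 + y • i := by
    intro d hd
    obtain ⟨s, t, hst⟩ := h d
    have : (d - (s • 1 + t • i)) * (d - (s • 1 - t • i)) = 0 := by
      rw [← hst]
      simp only [Algebra.algebraMap_eq_smul_one, sq, sub_mul, mul_sub, add_mul, smul_mul_assoc,
        mul_smul_comm, hd, hii, one_mul, mul_one, smul_neg, smul_smul, smul_sub, smul_add]
      module
    rcases mul_eq_zero.1 this with h0 | h0
    · exact ⟨s, t, sub_eq_zero.1 h0⟩
    · exact ⟨s, -t, by rw [sub_eq_zero.1 h0]; module⟩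
  by_cases hall : ∀ d : D, i * d = d * i
  · refine nonempty_algHom_of_surjective (Complex.liftAux i hii) (fun d => ?_) ofComplex
    obtain ⟨x, y, rfl⟩ := hcomm d (hall d)
    exact ⟨⟨x, y⟩, by simp [Complex.liftAux_apply, Algebra.algebraMap_eq_smul_one]⟩
  push Not at hall
  obtain ⟨d, hd⟩ := hall
  have hanti : ∀ d : D, i * (d + i * d * i) = -((d + i * d * i) * i) := by
    intro d
    rw [mul_add, add_mul, mul_assoc (i * d), hii, mul_assoc i d i, ← mul_assoc i i, hii]
    noncomm_ring
  obtain ⟨w, hw⟩ : ∃ w, w = d + i * d * i := ⟨_, rfl⟩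
  have hiw : i * w = -(w * i) := hw ▸ hanti d
  have hw0 : w ≠ 0 := by
    intro h0
    apply hd
    have : i * w = i * d - d * i := by
      rw [hw, mul_add, mul_assoc i d i, ← mul_assoc i i, hii]; noncomm_ring
    rw [h0, mul_zero] at this
    exact (sub_eq_zero.1 this.symm)
  have hwi_ne : w * i ≠ 0 := mul_ne_zero hw0 (by rintro rfl; simp at hii)
  have hww : ∃ c : ℝ, w * w = c • 1 := by
    obtain ⟨x, y, hxy⟩ := hcomm (w * w) (by
      rw [← mul_assoc, hiw, neg_mul, mul_assoc w i w, hiw, mul_neg, neg_neg, mul_assoc])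
    have h1 : w * (w * w) = w * w * w := (mul_assoc _ _ _).symm
    rw [hxy, mul_add, add_mul, mul_smul_comm, mul_smul_comm, smul_mul_assoc, smul_mul_assoc, hiw,
      mul_one, one_mul] at h1
    have h2 : (2 * y) • (w * i) = 0 := by
      have := add_left_cancel h1
      rw [smul_neg, eq_neg_iff_add_eq_zero] at this
      rw [← this]; module
    have hy : y = 0 := by simpa [hwi_ne] using h2
    exact ⟨x, by rw [hxy, hy]; module⟩
  obtain ⟨c, hc⟩ := hww
  have hc0 : c < 0 := by
    by_contra! hc0
    have : (w - √c • 1) * (w + √c • 1) = 0 := by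
      have : (w - √c • 1) * (w + √c • 1) = w * w - (√c * √c) • 1 := by
        simp only [sub_mul, mul_add, smul_mul_assoc, mul_smul_comm, one_mul, mul_one]
        module
      rw [this, Real.mul_self_sqrt hc0, hc, sub_self]
    have hreal : ∃ x : ℝ, w = x • 1 := by
      rcases mul_eq_zero.1 this with h0 | h0
      · exact ⟨_, sub_eq_zero.1 h0⟩
      · exact ⟨-√c, by rw [eq_neg_of_add_eq_zero_left h0]; module⟩
    obtain ⟨x, hx⟩ := hreal
    have : i * w = w * i := by rw [hx]; simp
    rw [this, eq_neg_iff_add_eq_zero, ← two_smul ℝ] at hiw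
    exact hwi_ne (by simpa using hiw)
  set j := (√(-c))⁻¹ • w with hj
  have hsq : √(-c) * √(-c) = -c := Real.mul_self_sqrt (by linarith)
  have hjj : j * j = -1 := by
    rw [hj, smul_mul_smul_comm, hc, smul_smul, ← mul_inv, hsq, inv_neg, neg_mul,
      inv_mul_cancel₀ hc0.ne, neg_one_smul]
  have hij : j * i = -(i * j) := by
    rw [hj, smul_mul_assoc, mul_smul_comm, hiw, smul_neg, neg_neg]
  let q : QuaternionAlgebra.Basis D (-1 : ℝ) 0 (-1) :=
    { i := i, j := j, k := i * j
      i_mul_i := by simp [hii]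
      j_mul_j := by simp [hjj]
      i_mul_j := rfl
      j_mul_i := by simp [hij] }
  refine nonempty_algHom_of_surjective (B := ℍ[ℝ]) q.liftHom (fun d => ?_) (AlgHom.id ℝ _)
  obtain ⟨x, y, hxy⟩ := hcomm (d - i * d * i) (by
    rw [mul_sub, sub_mul, mul_assoc (i * d), hii, mul_assoc i d i, ← mul_assoc i i, hii]
    noncomm_ring)
  obtain ⟨z, v, hzv⟩ := hcomm ((d + i * d * i) * j) (by
    have := hanti d
    rw [← mul_assoc, this, mul_assoc _ j i, hij, neg_mul, mul_neg, mul_assoc])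
  refine ⟨⟨x / 2, y / 2, -z / 2, -v / 2⟩, ?_⟩
  have h2 : d + i * d * i = -(z • j + v • (i * j)) := by
    have : (d + i * d * i) * j * j = (z • 1 + v • i) * j := by rw [hzv]
    rw [mul_assoc, hjj, mul_neg_one, add_mul, smul_mul_assoc, smul_mul_assoc, one_mul] at this
    rw [← this, neg_neg]
  have h3 : d = (1 / 2 : ℝ) • ((d - i * d * i) + (d + i * d * i)) := by module
  rw [h3, hxy, h2]
  change q.lift _ = _
  simp only [QuaternionAlgebra.Basis.lift, Algebra.algebraMap_eq_smul_one, q]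
  module

/-- The quotient norm makes the quotient by a closed two-sided ideal a normed ring. -/
noncomputable abbrev quotientNormedRing {A : Type*} [NormedRing A] (L : Ideal A) [L.IsTwoSided]
    [IsClosed (L : Set A)] : NormedRing (A ⧸ L) where
  __ := Submodule.Quotient.normedAddCommGroup L
  __ := Ideal.Quotient.ring L
  norm_mul_le x y := by
    have hlim : Tendsto (fun ε : ℝ => (‖x‖ + ε) * (‖y‖ + ε)) (nhdsWithin 0 (Set.Ioi 0))
        (nhds (‖x‖ * ‖y‖)) := by
      have : Continuous fun ε : ℝ => (‖x‖ + ε) * (‖y‖ + ε) := by fun_prop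
      simpa using (this.tendsto 0).mono_left nhdsWithin_le_nhds
    refine ge_of_tendsto hlim ?_
    filter_upwards [self_mem_nhdsWithin] with ε hε
    obtain ⟨a, rfl, ha⟩ := Submodule.Quotient.norm_mk_lt x hε
    obtain ⟨b, rfl, hb⟩ := Submodule.Quotient.norm_mk_lt y hε
    calc _ ≤ ‖a * b‖ := Submodule.Quotient.norm_mk_le L (a * b)
      _ ≤ ‖a‖ * ‖b‖ := norm_mul_le a b
      _ ≤ _ := mul_le_mul ha.le hb.le (norm_nonneg b) ((norm_nonneg a).trans ha.le)

/-- The quotient of a real Banach algebra by a two-sided ideal that is maximal as a left ideal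
embeds into the quaternions. -/
theorem nonempty_quotient_algHom_quaternion {A : Type*} [NormedRing A] [CompleteSpace A]
    [NormedAlgebra ℝ A] {L : Ideal A} [L.IsTwoSided] (hL : L.IsMaximal) :
    Nonempty ((A ⧸ L) →ₐ[ℝ] ℍ[ℝ]) := by
  have : IsClosed (L : Set A) := by
    rw [← hL.closure_eq]; exact isClosed_closure
  have hquad : ∀ d : A ⧸ L, ∃ s t : ℝ,
      (d - algebraMap ℝ (A ⧸ L) s) ^ 2 + algebraMap ℝ (A ⧸ L) (t ^ 2) = 0 := by
    intro d
    let : NormedRing (A ⧸ L) := quotientNormedRing L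
    let : NormedAlgebra ℝ (A ⧸ L) :=
      { Submodule.Quotient.normedSpace L ℝ, Ideal.Quotient.algebra ℝ with }
    have : Nontrivial (A ⧸ L) := Ideal.Quotient.nontrivial_iff.2 hL.ne_top
    obtain ⟨s, t, hst⟩ := exists_not_isUnit_sub_sq_add d
    refine ⟨s, t, ?_⟩
    by_contra hne
    let : DivisionRing (A ⧸ L) := Ideal.Quotient.divisionRing L
    exact hst (isUnit_iff_ne_zero.2 hne)
  let : DivisionRing (A ⧸ L) := Ideal.Quotient.divisionRing L
  exact nonempty_algHom_quaternion hquad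

/-- If all maximal left ideals are two-sided, then every non-unit lies in one of them. -/
theorem exists_isMaximal_mem_of_not_isUnit {R : Type*} [Ring R]
    (h : ∀ L : Ideal R, L.IsMaximal → L.IsTwoSided) {b : R} (hb : ¬ IsUnit b) :
    ∃ L : Ideal R, L.IsMaximal ∧ b ∈ L := by
  have key : ∀ c : R, (∀ d, d * c ≠ 1) → ∃ L : Ideal R, L.IsMaximal ∧ c ∈ L := by
    intro c hc
    obtain ⟨L, hL, hcL⟩ := Ideal.exists_le_maximal (Ideal.span {c}) (by
      rw [Ideal.ne_top_iff_one, Ideal.mem_span_singleton']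
      simpa using hc)
    exact ⟨L, hL, hcL (Ideal.mem_span_singleton_self c)⟩
  refine key b fun c hcb => ?_
  obtain ⟨L, hL, hcL⟩ := key c fun d hdc => hb <| by
    have hdb : d = b := left_inv_eq_right_inv hdc hcb
    exact ⟨⟨b, c, hdb ▸ hdc, hcb⟩, rfl⟩
  have := h L hL
  exact hL.ne_top (L.eq_top_iff_one.2 (hcb ▸ L.mul_mem_right b hcL))

/-- In a real unital Banach algebra whose norm is dominated by a multiple of the
spectral radius, `(a - s·e)² + t²·e` is non-invertible iff there is a (unital)
real-algebra homomorphism `x : A → ℍ` with `(x a - s)² + t² = 0` in `ℍ`. -/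
theorem not_isUnit_iff_exists_algHom_quaternion
    {A : Type*} [NormedRing A] [CompleteSpace A] [NormedAlgebra ℝ A]
    (r : A → ℝ)
    (hr : ∀ a : A, Tendsto (fun n : ℕ => ‖a ^ n‖ ^ (1 / (n : ℝ))) atTop (nhds (r a)))
    (m : ℝ) (hm : 0 < m)
    (hnorm : ∀ a : A, ‖a‖ ≤ m * r a)
    (a : A) (s t : ℝ) :
    ¬ IsUnit ((a - algebraMap ℝ A s) ^ 2 + algebraMap ℝ A (t ^ 2)) ↔
      ∃ x : A →ₐ[ℝ] ℍ[ℝ],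
        (x a - algebraMap ℝ ℍ[ℝ] s) ^ 2 + algebraMap ℝ ℍ[ℝ] (t ^ 2) = 0 := by
  constructor
  · intro hb
    have htwo : ∀ L : Ideal A, L.IsMaximal → L.IsTwoSided := fun L hL =>
      isTwoSided_of_isMaximal (norm_units_conj_le hr hm hnorm) hL
    obtain ⟨L, hL, hbL⟩ := exists_isMaximal_mem_of_not_isUnit htwo hb
    have := htwo L hL
    obtain ⟨x⟩ := nonempty_quotient_algHom_quaternion hL
    refine ⟨x.comp (Ideal.Quotient.mkₐ ℝ L), ?_⟩
    have h0 : x (Ideal.Quotient.mkₐ ℝ L _) = x 0 :=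
      congrArg x (Ideal.Quotient.eq_zero_iff_mem.2 hbL)
    simpa only [map_add, map_sub, map_pow, AlgHom.commutes, map_zero, AlgHom.comp_apply] using h0
  · rintro ⟨x, hx⟩ hb
    have := hb.map x
    rw [map_add, map_pow, map_sub, AlgHom.commutes, AlgHom.commutes, hx] at this
    exact not_isUnit_zero this
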